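/- Let p be a prime, f : 𝔽_{p^n} → 𝔽_p a function, and θ a positive real number such that |f̂(μ)| ∈ {0, √θ} for every μ ∈ 𝔽_{p^n}. Then there exists an integer 0 ≤ s ≤ n such that θ = p^{n+s} and #{μ ∈ 𝔽_{p^n} : f̂(μ) ≠ 0} = p^{n−s}. -/

import Mathlib

open scoped BigOperators Classical

noncomputable instance galFintype (p n : ℕ) [Fact p.Prime] : Fintype (GaloisField p n) :=
  Fintype.ofFinite _

/-- `eChar p k = ζ_p ^ k` where `ζ_p = exp(2πi/p)` and `k : ZMod p`. -/
noncomputable def eChar (p : ℕ) (k : ZMod p) : ℂ :=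
  Complex.exp (2 * Real.pi * Complex.I / p) ^ k.val

/-- Absolute trace `Tr_n : 𝔽_{p^n} → 𝔽_p`. -/
noncomputable def trGF (p n : ℕ) [Fact p.Prime] (x : GaloisField p n) : ZMod p :=
  Algebra.trace (ZMod p) (GaloisField p n) x

/-- Walsh transform `f̂(μ) = ∑_x ζ_p^{f(x) - Tr_n(μ x)}`. -/
noncomputable def walsh (p n : ℕ) [Fact p.Prime] (f : GaloisField p n → ZMod p)
    (μ : GaloisField p n) : ℂ :=
  ∑ x : GaloisField p n, eChar p (f x - trGF p n (μ * x))

/-- `f` is `s`-plateaued: `|f̂(μ)| ∈ {0, p^{(n+s)/2}}` for all `μ`. -/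
def IsPlateaued (p n : ℕ) [Fact p.Prime] (f : GaloisField p n → ZMod p) (s : ℕ) : Prop :=
  ∀ μ : GaloisField p n, ‖walsh p n f μ‖ = 0 ∨
    ‖walsh p n f μ‖ = (p : ℝ) ^ (((n : ℝ) + (s : ℝ)) / 2)

/-- `δ_S(g) = #{(s,t) ∈ S × S : g = s - t}`. -/
def pgdsDelta {G : Type*} [AddCommGroup G] [DecidableEq G] (S : Finset G) (g : G) : ℕ :=
  ((S ×ˢ S).filter fun st => g = st.1 - st.2).card

/-- `S` is a partial geometric difference set with parameters `(v, k; α, β)`. -/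
def IsPGDS {G : Type*} [AddCommGroup G] [Fintype G] [DecidableEq G]
    (S : Finset G) (v k α β : ℕ) : Prop :=
  Fintype.card G = v ∧ S.card = k ∧
    ∀ x : G, (∑ y ∈ S, pgdsDelta S (x - y)) = if x ∈ S then β else α

/-- `eChar` is the standard additive character of `ZMod p`. -/
theorem eChar_eq_stdAddChar (p : ℕ) [NeZero p] (k : ZMod p) : eChar p k = ZMod.stdAddChar k := by
  conv_rhs => rw [← ZMod.natCast_zmod_val k]
  have := ZMod.stdAddChar_coe (N := p) (k.val : ℤ)
  rw [Int.cast_natCast] at this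
  rw [this, eChar, ← Complex.exp_nat_mul]
  congr 1
  push_cast
  ring

theorem isIntegral_eChar (p : ℕ) (k : ZMod p) [NeZero p] : IsIntegral ℤ (eChar p k) :=
  ((Complex.isPrimitiveRoot_exp p (NeZero.ne p)).isIntegral (NeZero.pos p)).pow _

theorem isIntegral_walsh (p n : ℕ) [Fact p.Prime] (f : GaloisField p n → ZMod p)
    (μ : GaloisField p n) : IsIntegral ℤ (walsh p n f μ) :=
  IsIntegral.sum _ fun _ _ => isIntegral_eChar p _

/-- The canonical additive character `x ↦ ζ_p ^ Tr_n x` of `𝔽_{p^n}`. -/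
noncomputable def traceAddChar (p n : ℕ) [Fact p.Prime] : AddChar (GaloisField p n) ℂ :=
  ZMod.stdAddChar.compAddMonoidHom
    (Algebra.trace (ZMod p) (GaloisField p n)).toAddMonoidHom

theorem traceAddChar_apply (p n : ℕ) [Fact p.Prime] (x : GaloisField p n) :
    traceAddChar p n x = ZMod.stdAddChar (trGF p n x) := rfl

theorem traceAddChar_isPrimitive (p n : ℕ) [Fact p.Prime] : (traceAddChar p n).IsPrimitive := by
  apply AddChar.IsPrimitive.of_ne_one
  obtain ⟨x, hx⟩ := Algebra.trace_surjective (ZMod p) (GaloisField p n) 1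
  rw [AddChar.ne_one_iff]
  refine ⟨x, fun h => one_ne_zero (α := ZMod p) (ZMod.injective_stdAddChar ?_)⟩
  rw [AddChar.map_zero_eq_one, ← h, traceAddChar_apply, trGF, hx]

theorem walsh_eq_sum (p n : ℕ) [Fact p.Prime] (f : GaloisField p n → ZMod p)
    (μ : GaloisField p n) :
    walsh p n f μ = ∑ x, ZMod.stdAddChar (f x) * traceAddChar p n (-(μ * x)) := by
  refine Finset.sum_congr rfl fun x _ => ?_
  rw [eChar_eq_stdAddChar, sub_eq_add_neg, AddChar.map_add_eq_mul, traceAddChar_apply, trGF, trGF,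
    map_neg (Algebra.trace (ZMod p) (GaloisField p n))]

theorem conj_walsh (p n : ℕ) [Fact p.Prime] (f : GaloisField p n → ZMod p)
    (μ : GaloisField p n) :
    (starRingEnd ℂ) (walsh p n f μ) =
      ∑ y, ZMod.stdAddChar (-f y) * traceAddChar p n (μ * y) := by
  simp only [walsh_eq_sum, map_sum, map_mul, ← AddChar.map_neg_eq_conj, neg_neg]

/-- Parseval's identity for the Walsh transform. -/
theorem sum_walsh_mul_conj (p n : ℕ) [Fact p.Prime] (f : GaloisField p n → ZMod p) :
    ∑ μ, walsh p n f μ * (starRingEnd ℂ) (walsh p n f μ) =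
      (Fintype.card (GaloisField p n) : ℂ) ^ 2 := by
  have key (x y : GaloisField p n) :
      ∑ μ, ZMod.stdAddChar (f x) * traceAddChar p n (-(μ * x)) *
        (ZMod.stdAddChar (-f y) * traceAddChar p n (μ * y)) =
      if y = x then (Fintype.card (GaloisField p n) : ℂ) else 0 := by
    have hterm (μ : GaloisField p n) :
        ZMod.stdAddChar (f x) * traceAddChar p n (-(μ * x)) *
          (ZMod.stdAddChar (-f y) * traceAddChar p n (μ * y)) =
        ZMod.stdAddChar (f x - f y) * traceAddChar p n (μ * (y - x)) := by
      rw [mul_mul_mul_comm, ← AddChar.map_add_eq_mul, ← AddChar.map_add_eq_mul]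
      congr 2 <;> ring
    simp_rw [hterm, ← Finset.mul_sum]
    rw [AddChar.sum_mulShift _ (traceAddChar_isPrimitive p n)]
    by_cases hxy : y = x
    · simp [hxy]
    · simp [hxy, sub_eq_zero]
  simp_rw [conj_walsh, walsh_eq_sum, Finset.sum_mul_sum]
  rw [Finset.sum_comm]
  simp_rw [Finset.sum_comm (s := (Finset.univ : Finset (GaloisField p n))) (t := Finset.univ)
    (f := fun μ y => ZMod.stdAddChar (f _) * traceAddChar p n (-(μ * _)) *
        (ZMod.stdAddChar (-f y) * traceAddChar p n (μ * y))), key]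
  simp [sq]

theorem sum_norm_walsh_sq (p n : ℕ) [Fact p.Prime] (f : GaloisField p n → ZMod p) :
    ∑ μ, ‖walsh p n f μ‖ ^ 2 = (Fintype.card (GaloisField p n) : ℝ) ^ 2 := by
  have := sum_walsh_mul_conj p n f
  simp_rw [Complex.mul_conj'] at this
  exact_mod_cast this

/-- A positive real, integral over `ℤ`, with a natural multiple `N * θ = M`, is a natural number. -/
theorem exists_natCast_eq_of_isIntegral {θ : ℝ} (hθ : 0 < θ) (hint : IsIntegral ℤ (θ : ℂ))
    {N M : ℕ} (hM : M ≠ 0) (hNM : N * θ = M) : ∃ t : ℕ, θ = t := by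
  have hN : (N : ℝ) ≠ 0 := by
    rintro h0
    rw [h0, zero_mul] at hNM
    exact hM (by exact_mod_cast hNM.symm)
  have hq : (θ : ℂ) = algebraMap ℚ ℂ (M / N) := by
    have : θ = M / N := by rw [← hNM]; field_simp
    simp [this]
  rw [hq, isIntegral_algebraMap_iff (algebraMap ℚ ℂ).injective,
    IsIntegrallyClosed.isIntegral_iff] at hint
  obtain ⟨z, hz⟩ := hint
  have hz' : θ = z := by
    rw [← hz] at hq
    simp only [eq_intCast, map_intCast] at hq
    exact_mod_cast hq
  have hz0 : 0 ≤ z := by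
    rw [hz'] at hθ
    exact_mod_cast hθ.le
  lift z to ℕ using hz0
  exact ⟨z, by exact_mod_cast hz'⟩

/-- if `|f̂(μ)| ∈ {0, √θ}` for all `μ`, then `θ = p^{n+s}` for some
`0 ≤ s ≤ n` and the Walsh support has exactly `p^{n-s}` elements. -/
theorem stmt8 (p n : ℕ) [Fact p.Prime] (hn : 0 < n) (f : GaloisField p n → ZMod p)
    (θ : ℝ) (hθ : 0 < θ)
    (h : ∀ μ : GaloisField p n, ‖walsh p n f μ‖ = 0 ∨
      ‖walsh p n f μ‖ = Real.sqrt θ) :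
    ∃ s : ℕ, s ≤ n ∧ θ = (p : ℝ) ^ (n + s) ∧
      ((Finset.univ : Finset (GaloisField p n)).filter fun μ => walsh p n f μ ≠ 0).card =
        p ^ (n - s) := by
  have hp : p.Prime := Fact.out
  have hcard : Fintype.card (GaloisField p n) = p ^ n := by
    rw [← Nat.card_eq_fintype_card, GaloisField.card p n hn.ne']
  set S := (Finset.univ : Finset (GaloisField p n)).filter fun μ => walsh p n f μ ≠ 0 with hS
  have hsq (μ : GaloisField p n) (hμ : walsh p n f μ ≠ 0) : ‖walsh p n f μ‖ ^ 2 = θ := by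
    rw [(h μ).resolve_left (norm_ne_zero_iff.mpr hμ), Real.sq_sqrt hθ.le]
  have hNθ : (S.card : ℝ) * θ = ((p ^ (2 * n) : ℕ) : ℝ) := by
    have hsum : ∑ μ, ‖walsh p n f μ‖ ^ 2 = S.card * θ := by
      rw [← nsmul_eq_mul, ← Finset.sum_const, hS, Finset.sum_filter]
      refine Finset.sum_congr rfl fun μ _ => ?_
      split_ifs with hμ
      · exact hsq μ hμ
      · simp [not_not.mp hμ]
    rw [← hsum, sum_norm_walsh_sq, hcard]
    push_cast
    ring
  have hpos : p ^ (2 * n) ≠ 0 := pow_ne_zero _ hp.ne_zero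
  have hne : S.Nonempty := by
    rw [Finset.nonempty_iff_ne_empty]
    intro h0
    rw [h0, Finset.card_empty, Nat.cast_zero, zero_mul] at hNθ
    exact hpos (by exact_mod_cast hNθ.symm)
  obtain ⟨μ, hμ⟩ := hne
  have hint : IsIntegral ℤ (θ : ℂ) := by
    rw [← hsq μ (Finset.mem_filter.mp hμ).2, Complex.ofReal_pow, ← Complex.mul_conj']
    have hw := isIntegral_walsh p n f μ
    exact hw.mul (hw.map ((starRingEnd ℂ).toIntAlgHom))
  obtain ⟨t, rfl⟩ := exists_natCast_eq_of_isIntegral hθ hint hpos hNθ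
  have hmul : S.card * t = p ^ (2 * n) := by exact_mod_cast hNθ
  obtain ⟨k, hk, rfl⟩ := (Nat.dvd_prime_pow hp).mp (Dvd.intro_left _ hmul)
  have hSk : S.card = p ^ (2 * n - k) := by
    refine Nat.eq_of_mul_eq_mul_right (pow_pos hp.pos k) ?_
    rw [hmul, ← pow_add, Nat.sub_add_cancel hk]
  have hle : 2 * n - k ≤ n := by
    rw [← Nat.pow_le_pow_iff_right hp.one_lt, ← hSk, ← hcard]
    exact Finset.card_le_univ S
  refine ⟨k - n, by omega, ?_, ?_⟩
  · rw [Nat.add_sub_cancel' (by omega)]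
    push_cast
    rfl
  · rw [hSk]
    congr 1
    omega
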